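/- arXiv:1410.8100 — 2 statements merged into one kernel-verified Lean document; each statement's English description precedes it below -/
import Mathlib

section
/- Let 0 < x ≤ y < 1 and 0 ≤ ρ₁ ≤ ρ₂ ≤ 1/2. Then D(T_{ρ₂}(x,y)) ≤ D(T_{ρ₁}(x,y)); that is, the Kullback–Leibler divergence of the BSC-transformed operating point is a monotonically nonincreasing function of the crossover probability ρ on [0, 1/2] whenever y ≥ x. -/
/-- The binary Kullback–Leibler divergence of an operating point `(x, y)`. -/
noncomputable def klBin (x y : ℝ) : ℝ :=
  x * Real.log (x / y) + (1 - x) * Real.log ((1 - x) / (1 - y))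

/-- The BSC transform of an operating point `(x,y)` with crossover probability `ρ`. -/
noncomputable def bscT (ρ : ℝ) (p : ℝ × ℝ) : ℝ × ℝ :=
  (ρ + (1 - 2 * ρ) * p.1, ρ + (1 - 2 * ρ) * p.2)

/-- The tangent-line bound `log u ≤ u - 1` applied to a ratio of likelihood ratios. -/
lemma mul_log_div_sub_le {a c A C : ℝ} (ha : 0 < a) (hc : 0 < c) (hA : 0 < A) (hC : 0 < C) :
    a * Real.log (A / C) - a * Real.log (a / c) ≤ A * c / C - a := by
  have h := Real.log_le_sub_one_of_pos (div_pos (div_pos hA hC) (div_pos ha hc))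
  rw [Real.log_div (div_pos hA hC).ne' (div_pos ha hc).ne'] at h
  calc a * Real.log (A / C) - a * Real.log (a / c)
      = a * (Real.log (A / C) - Real.log (a / c)) := by ring
    _ ≤ a * (A / C / (a / c) - 1) := by gcongr
    _ = A * c / C - a := by field_simp

/-- The weighted two-term log-sum inequality. -/
lemma log_sum_le {a b c d s t : ℝ} (ha : 0 < a) (hb : 0 < b) (hc : 0 < c) (hd : 0 < d)
    (hs : 0 ≤ s) (ht : 0 ≤ t) (hst : 0 < s + t) :
    (s * a + t * b) * Real.log ((s * a + t * b) / (s * c + t * d)) ≤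
      s * (a * Real.log (a / c)) + t * (b * Real.log (b / d)) := by
  have pos {u v : ℝ} (hu : 0 < u) (hv : 0 < v) : 0 < s * u + t * v := by
    rcases hs.eq_or_lt with rfl | hs
    · have : 0 < t := by linarith
      positivity
    · positivity
  have hA := pos ha hb
  have hC := pos hc hd
  have h₁ := mul_le_mul_of_nonneg_left (mul_log_div_sub_le ha hc hA hC) hs
  have h₂ := mul_le_mul_of_nonneg_left (mul_log_div_sub_le hb hd hA hC) ht
  have h₃ : s * ((s * a + t * b) * c / (s * c + t * d) - a) +
      t * ((s * a + t * b) * d / (s * c + t * d) - b) = 0 := by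
    field_simp
    ring
  linarith

/-- The data processing inequality for the binary symmetric channel. -/
lemma klBin_bscT_le {x y r : ℝ} (hx : 0 < x) (hx1 : x < 1) (hy : 0 < y) (hy1 : y < 1)
    (hr : 0 ≤ r) (hr1 : r ≤ 1) :
    klBin (bscT r (x, y)).1 (bscT r (x, y)).2 ≤ klBin x y := by
  have h₁ := log_sum_le hx (sub_pos.2 hx1) hy (sub_pos.2 hy1) (sub_nonneg.2 hr1) hr (by linarith)
  have h₂ := log_sum_le hx (sub_pos.2 hx1) hy (sub_pos.2 hy1) hr (sub_nonneg.2 hr1) (by linarith)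
  have e₁ (z : ℝ) : r + (1 - 2 * r) * z = (1 - r) * z + r * (1 - z) := by ring
  have e₂ (z : ℝ) : 1 - ((1 - r) * z + r * (1 - z)) = r * z + (1 - r) * (1 - z) := by ring
  simp only [klBin, bscT, e₁, e₂]
  linarith

/-- Binary symmetric channels compose to a binary symmetric channel. -/
lemma bscT_bscT (r ρ : ℝ) (p : ℝ × ℝ) :
    bscT r (bscT ρ p) = bscT (r + (1 - 2 * r) * ρ) p := by
  ext <;> simp only [bscT] <;> ring

/-- The transform maps the open unit interval into itself. -/
lemma bsc_mem_Ioo {ρ z : ℝ} (hρ : 0 ≤ ρ) (hρ' : ρ < 1 / 2) (hz : z ∈ Set.Ioo (0 : ℝ) 1) :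
    ρ + (1 - 2 * ρ) * z ∈ Set.Ioo (0 : ℝ) 1 := by
  obtain ⟨h₀, h₁⟩ := hz
  have hk : 0 < 1 - 2 * ρ := by linarith
  constructor <;> nlinarith [mul_pos hk h₀, mul_pos hk (sub_pos.2 h₁)]

/-- For `0 < x ≤ y < 1` and `0 ≤ ρ₁ ≤ ρ₂ ≤ 1/2`, the KL divergence of the
BSC-transformed operating point is nonincreasing in the crossover probability:
`D(T_{ρ₂}(x,y)) ≤ D(T_{ρ₁}(x,y))`. -/
theorem klBin_bscT_antitone (x y ρ₁ ρ₂ : ℝ)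
    (hx : 0 < x) (hxy : x ≤ y) (hy : y < 1)
    (h1 : 0 ≤ ρ₁) (h12 : ρ₁ ≤ ρ₂) (h2 : ρ₂ ≤ 1/2) :
    klBin (bscT ρ₂ (x, y)).1 (bscT ρ₂ (x, y)).2 ≤
      klBin (bscT ρ₁ (x, y)).1 (bscT ρ₁ (x, y)).2 := by
  rcases (h12.trans h2).eq_or_lt with h | h
  · rw [show ρ₂ = ρ₁ by linarith]
  have hk : 0 < 1 - 2 * ρ₁ := by linarith
  set r := (ρ₂ - ρ₁) / (1 - 2 * ρ₁)
  have hr0 : 0 ≤ r := div_nonneg (sub_nonneg.2 h12) hk.le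
  have hr1 : r ≤ 1 := (div_le_one hk).2 (by linarith)
  have hcomp : r + (1 - 2 * r) * ρ₁ = ρ₂ := by
    have : r * (1 - 2 * ρ₁) = ρ₂ - ρ₁ := div_mul_cancel₀ _ hk.ne'
    linarith
  have hX := bsc_mem_Ioo h1 h ⟨hx, hxy.trans_lt hy⟩
  have hY := bsc_mem_Ioo h1 h ⟨hx.trans_le hxy, hy⟩
  have key := klBin_bscT_le hX.1 hX.2 hY.1 hY.2 hr0 hr1
  rw [← hcomp, ← bscT_bscT]
  exact key
end

section
/- Let 0 ≤ ρ_e < 1/2, let I be an open interval, let y : ℝ → ℝ be twice differentiable at x₀ ∈ I, and define x_e(t) = ρ_e + (1−2ρ_e)t and y_e(t) = ρ_e + (1−2ρ_e)y(t). Assume 0 < x_e(x₀) < y_e(x₀) < 1 and that there is a constant α̃ with D(x_e(t), y_e(t)) = α̃ for all t ∈ I. Then, writing x_e = x_e(x₀) and y_e = y_e(x₀), the second derivative of the constraint curve satisfies ((1−x_e)/(1−y_e) − x_e/y_e)·y″(x₀) = (1−2ρ_e)·[ −((1−x_e)/(1−y_e)² + x_e/y_e²)·(y′(x₀))² + 2·(1/y_e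 + 1/(1−y_e))·y′(x₀) − (1/x_e + 1/(1−x_e)) ]. -/
/-- The derivative of `log (u / v)` along a curve with nonzero coordinates. -/
theorem HasDerivAt.log_div {u v : ℝ → ℝ} {u' v' t : ℝ} (hu : HasDerivAt u u' t)
    (hv : HasDerivAt v v' t) (hu0 : u t ≠ 0) (hv0 : v t ≠ 0) :
    HasDerivAt (fun s => Real.log (u s / v s)) (u' / u t - v' / v t) t := by
  refine ((hu.fun_div hv hv0).log (div_ne_zero hu0 hv0)).congr_deriv ?_
  field_simp

/-- The chain rule for the binary Kullback–Leibler divergence along a curve. -/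
theorem HasDerivAt.klBin_comp {u v : ℝ → ℝ} {u' v' t : ℝ} (hu : HasDerivAt u u' t)
    (hv : HasDerivAt v v' t) (hu0 : u t ≠ 0) (hu1 : 1 - u t ≠ 0) (hv0 : v t ≠ 0)
    (hv1 : 1 - v t ≠ 0) :
    HasDerivAt (fun s => klBin (u s) (v s))
      ((Real.log (u t / v t) - Real.log ((1 - u t) / (1 - v t))) * u'
        + ((1 - u t) / (1 - v t) - u t / v t) * v') t := by
  refine ((hu.fun_mul (hu.log_div hv hu0 hv0)).fun_add ((hu.const_sub 1).fun_mul
    ((hu.const_sub 1).log_div (hv.const_sub 1) hu1 hv1))).congr_deriv ?_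
  field_simp
  ring

/-- The second-order chain rule for the binary Kullback–Leibler divergence, stated as the
derivative of the expression in `HasDerivAt.klBin_comp`. -/
theorem HasDerivAt.klBin_chain {u v du dv : ℝ → ℝ} {u₂ v₂ t : ℝ} (hu : HasDerivAt u (du t) t)
    (hv : HasDerivAt v (dv t) t) (hdu : HasDerivAt du u₂ t) (hdv : HasDerivAt dv v₂ t)
    (hu0 : u t ≠ 0) (hu1 : 1 - u t ≠ 0) (hv0 : v t ≠ 0) (hv1 : 1 - v t ≠ 0) :
    HasDerivAt (fun s => (Real.log (u s / v s) - Real.log ((1 - u s) / (1 - v s))) * du s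
        + ((1 - u s) / (1 - v s) - u s / v s) * dv s)
      ((1 / u t + 1 / (1 - u t)) * du t ^ 2 - 2 * (1 / v t + 1 / (1 - v t)) * (du t * dv t)
        + ((1 - u t) / (1 - v t) ^ 2 + u t / v t ^ 2) * dv t ^ 2
        + (Real.log (u t / v t) - Real.log ((1 - u t) / (1 - v t))) * u₂
        + ((1 - u t) / (1 - v t) - u t / v t) * v₂) t := by
  have hu' := hu.const_sub 1
  have hv' := hv.const_sub 1
  refine ((((hu.log_div hv hu0 hv0).fun_sub (hu'.log_div hv' hu1 hv1)).fun_mul hdu).fun_add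
    (((hu'.fun_div hv' hv1).fun_sub (hu.fun_div hv hv0)).fun_mul hdv)).congr_deriv ?_
  field_simp
  ring

/-- If the operating point `(t, y(t))` stays on the eavesdropper's constraint
boundary `D(x_e, y_e) = α̃`, where `x_e(t) = ρ_e + (1-2ρ_e)t` and
`y_e(t) = ρ_e + (1-2ρ_e)y(t)`, and `y` is twice differentiable at `x₀`, then
`((1-x_e)/(1-y_e) − x_e/y_e)·y″(x₀)
  = (1-2ρ_e)·[ −((1-x_e)/(1-y_e)² + x_e/y_e²)·(y′(x₀))²
      + 2·(1/y_e + 1/(1-y_e))·y′(x₀) − (1/x_e + 1/(1-x_e)) ]`. -/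
theorem eve_constraint_second_derivative (ρe a b x₀ αt : ℝ) (y : ℝ → ℝ)
    (hρ0 : 0 ≤ ρe) (hρ : ρe < 1/2)
    (hx₀ : x₀ ∈ Set.Ioo a b)
    (hdiff : ∀ t ∈ Set.Ioo a b, DifferentiableAt ℝ y t)
    (hdiff2 : DifferentiableAt ℝ (deriv y) x₀)
    (hxe : 0 < ρe + (1 - 2 * ρe) * x₀)
    (hxye : ρe + (1 - 2 * ρe) * x₀ < ρe + (1 - 2 * ρe) * y x₀)
    (hye : ρe + (1 - 2 * ρe) * y x₀ < 1)
    (hconst : ∀ t ∈ Set.Ioo a b,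
      klBin (ρe + (1 - 2 * ρe) * t) (ρe + (1 - 2 * ρe) * y t) = αt) :
    ((1 - (ρe + (1 - 2 * ρe) * x₀)) / (1 - (ρe + (1 - 2 * ρe) * y x₀))
        - (ρe + (1 - 2 * ρe) * x₀) / (ρe + (1 - 2 * ρe) * y x₀))
      * deriv (deriv y) x₀ =
    (1 - 2 * ρe) *
      ( - ((1 - (ρe + (1 - 2 * ρe) * x₀)) / (1 - (ρe + (1 - 2 * ρe) * y x₀)) ^ 2
            + (ρe + (1 - 2 * ρe) * x₀) / (ρe + (1 - 2 * ρe) * y x₀) ^ 2)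
          * (deriv y x₀) ^ 2
        + 2 * (1 / (ρe + (1 - 2 * ρe) * y x₀)
            + 1 / (1 - (ρe + (1 - 2 * ρe) * y x₀))) * deriv y x₀
        - (1 / (ρe + (1 - 2 * ρe) * x₀)
            + 1 / (1 - (ρe + (1 - 2 * ρe) * x₀)))) := by
  have hc : 1 - 2 * ρe ≠ 0 := by linarith
  have hu (t : ℝ) : HasDerivAt (fun s => ρe + (1 - 2 * ρe) * s) (1 - 2 * ρe) t := by
    simpa using ((hasDerivAt_id t).const_mul (1 - 2 * ρe)).const_add ρe
  have hv (t : ℝ) (ht : t ∈ Set.Ioo a b) :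
      HasDerivAt (fun s => ρe + (1 - 2 * ρe) * y s) ((1 - 2 * ρe) * deriv y t) t :=
    ((hdiff t ht).hasDerivAt.const_mul _).const_add ρe
  have hI : ∀ᶠ t in nhds x₀, t ∈ Set.Ioo a b := isOpen_Ioo.mem_nhds hx₀
  have hu0 := hxe.ne'
  have hu1 : 1 - (ρe + (1 - 2 * ρe) * x₀) ≠ 0 := by linarith
  have hv0 := (hxe.trans hxye).ne'
  have hv1 : 1 - (ρe + (1 - 2 * ρe) * y x₀) ≠ 0 := by linarith
  have huc := (hu x₀).continuousAt
  have hvc := (hv x₀ hx₀).continuousAt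
  have hchain := HasDerivAt.klBin_chain (du := fun _ => 1 - 2 * ρe)
      (dv := fun t => (1 - 2 * ρe) * deriv y t) (hu x₀) (hv x₀ hx₀) (hasDerivAt_const x₀ _)
      (hdiff2.hasDerivAt.const_mul _) hu0 hu1 hv0 hv1
  have hzero : (fun t => (Real.log ((ρe + (1 - 2 * ρe) * t) / (ρe + (1 - 2 * ρe) * y t))
        - Real.log ((1 - (ρe + (1 - 2 * ρe) * t)) / (1 - (ρe + (1 - 2 * ρe) * y t))))
          * (1 - 2 * ρe)
      + ((1 - (ρe + (1 - 2 * ρe) * t)) / (1 - (ρe + (1 - 2 * ρe) * y t))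
        - (ρe + (1 - 2 * ρe) * t) / (ρe + (1 - 2 * ρe) * y t)) * ((1 - 2 * ρe) * deriv y t))
      =ᶠ[nhds x₀] fun _ => 0 := by
    filter_upwards [hI, huc.eventually_ne hu0, hvc.eventually_ne hv0,
      (huc.const_sub 1).eventually_ne hu1, (hvc.const_sub 1).eventually_ne hv1]
      with t ht h0 k0 h1 k1
    refine ((hu t).klBin_comp (hv t ht) h0 h1 k0 k1).unique
      ((hasDerivAt_const t αt).congr_of_eventuallyEq ?_)
    filter_upwards [isOpen_Ioo.mem_nhds ht] with s hs using hconst s hs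
  have hsecond := hchain.unique ((hasDerivAt_const x₀ (0 : ℝ)).congr_of_eventuallyEq hzero)
  refine mul_left_cancel₀ hc ?_
  linear_combination hsecond
end
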